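/- arXiv:math/9910069 — 2 statements merged into one kernel-verified Lean document; each statement's English description precedes it below -/
import Mathlib

section
/- For every element g of the even subalgebra of Cl₀,₃ (the subalgebra of even-grade elements) and every vector v ∈ ℝ³, the element g·ι(v)·star(g) lies in the image of ι; that is, under the Spin-type action x ↦ g·x·star(g), 1-vectors are automatically mapped to 1-vectors. -/
noncomputable section

open CliffordAlgebra

/-- The negative definite quadratic form on `ℝ³`: `Q₃ x = -(x₀² + x₁² + x₂²)`. -/
def Q3 : QuadraticForm ℝ (Fin 3 → ℝ) :=
  QuadraticMap.weightedSumSquares ℝ (fun _ : Fin 3 => (-1 : ℝ))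

/-- Clifford conjugation: grade involution followed by reversion. -/
def cstar (x : CliffordAlgebra Q3) : CliffordAlgebra Q3 :=
  reverse (involute x)

/-- The standard generator `eᵢ` of the Clifford algebra of `Q3`. -/
def stdGen (i : Fin 3) : CliffordAlgebra Q3 :=
  ι Q3 (Pi.single i 1)

theorem ι_eq_stdGen (v : Fin 3 → ℝ) :
    ι Q3 v = v 0 • stdGen 0 + v 1 • stdGen 1 + v 2 • stdGen 2 := by
  simp only [stdGen, ← map_smul, ← map_add]
  congr 1
  ext i
  fin_cases i <;> simp

theorem stdGen_mul_self (i : Fin 3) : stdGen i * stdGen i = -1 := by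
  rw [stdGen, ι_sq_scalar]
  have h : Q3 (Pi.single i 1) = -1 := by
    fin_cases i <;> simp [Q3, QuadraticMap.weightedSumSquares_apply, Fin.sum_univ_three]
  rw [h, map_neg, map_one]

theorem stdGen_mul_swap {i j : Fin 3} (hij : i ≠ j) :
    stdGen i * stdGen j = -(stdGen j * stdGen i) := by
  rw [← add_eq_zero_iff_eq_neg, stdGen, stdGen, ι_mul_ι_add_swap]
  have h : QuadraticMap.polar Q3 (Pi.single i 1) (Pi.single j 1) = 0 := by
    revert hij
    fin_cases i <;> fin_cases j <;>
      simp [Q3, QuadraticMap.polar, QuadraticMap.weightedSumSquares_apply, Fin.sum_univ_three]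
  rw [h, map_zero]

theorem stdGen_mul_self_mul (i : Fin 3) (x : CliffordAlgebra Q3) :
    stdGen i * (stdGen i * x) = -x := by
  rw [← mul_assoc, stdGen_mul_self, neg_one_mul]

theorem stdGen_mul_swap_mul {i j : Fin 3} (hij : i ≠ j) (x : CliffordAlgebra Q3) :
    stdGen i * (stdGen j * x) = -(stdGen j * (stdGen i * x)) := by
  rw [← mul_assoc, stdGen_mul_swap hij, neg_mul, mul_assoc]

/-- The pseudoscalar `e₁e₂e₃`. -/
def pseudoscalar : CliffordAlgebra Q3 :=
  stdGen 0 * (stdGen 1 * stdGen 2)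

theorem star_stdGen (i : Fin 3) : star (stdGen i) = -stdGen i :=
  star_ι _

theorem star_pseudoscalar : star pseudoscalar = pseudoscalar := by
  have h10 : (1 : Fin 3) ≠ 0 := by decide
  have h20 : (2 : Fin 3) ≠ 0 := by decide
  have h21 : (2 : Fin 3) ≠ 1 := by decide
  simp only [pseudoscalar, star_mul, star_stdGen, mul_assoc, neg_mul, mul_neg, neg_neg,
    stdGen_mul_swap h20, stdGen_mul_swap h21,
    stdGen_mul_swap_mul h10]

/-- Every odd element is the sum of a vector and a multiple of the pseudoscalar. -/
theorem exists_eq_ι_add_smul_pseudoscalar {x : CliffordAlgebra Q3} (hx : x ∈ evenOdd Q3 1) :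
    ∃ (w : Fin 3 → ℝ) (s : ℝ), x = ι Q3 w + s • pseudoscalar := by
  have h10 : (1 : Fin 3) ≠ 0 := by decide
  have h20 : (2 : Fin 3) ≠ 0 := by decide
  have h21 : (2 : Fin 3) ≠ 1 := by decide
  induction x, hx using odd_induction with
  | ι v => exact ⟨v, 0, by simp⟩
  | add x y _ _ hx hy =>
    obtain ⟨w, s, rfl⟩ := hx
    obtain ⟨w', s', rfl⟩ := hy
    exact ⟨w + w', s + s', by rw [map_add]; module⟩
  | ι_mul_ι_mul m n x _ hx =>
    obtain ⟨w, s, rfl⟩ := hx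
    refine ⟨![-(m 0 * (n 0 * w 0 + n 1 * w 1 + n 2 * w 2))
          + m 1 * (n 0 * w 1 - n 1 * w 0 - n 2 * s) + m 2 * (n 0 * w 2 - n 2 * w 0 + n 1 * s),
        -(m 1 * (n 0 * w 0 + n 1 * w 1 + n 2 * w 2))
          - m 0 * (n 0 * w 1 - n 1 * w 0 - n 2 * s) + m 2 * (n 1 * w 2 - n 2 * w 1 - n 0 * s),
        -(m 2 * (n 0 * w 0 + n 1 * w 1 + n 2 * w 2))
          - m 0 * (n 0 * w 2 - n 2 * w 0 + n 1 * s) - m 1 * (n 1 * w 2 - n 2 * w 1 - n 0 * s)],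
      -(s * (m 0 * n 0 + m 1 * n 1 + m 2 * n 2))
        + m 0 * (n 1 * w 2 - n 2 * w 1) - m 1 * (n 0 * w 2 - n 2 * w 0)
        + m 2 * (n 0 * w 1 - n 1 * w 0), ?_⟩
    simp only [ι_eq_stdGen, pseudoscalar, mul_add, add_mul, smul_mul_assoc, mul_smul_comm,
      mul_assoc, neg_mul, mul_neg, neg_neg, smul_neg, one_mul, mul_one, stdGen_mul_self,
      stdGen_mul_self_mul, stdGen_mul_swap h10, stdGen_mul_swap h20, stdGen_mul_swap h21,
      stdGen_mul_swap_mul h10, stdGen_mul_swap_mul h20, stdGen_mul_swap_mul h21,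
      Matrix.cons_val]
    module

theorem mem_range_ι_of_odd_of_star_eq_neg {x : CliffordAlgebra Q3} (hx : x ∈ evenOdd Q3 1)
    (h : star x = -x) : x ∈ LinearMap.range (ι Q3) := by
  obtain ⟨w, s, rfl⟩ := exists_eq_ι_add_smul_pseudoscalar hx
  have : IsAddTorsionFree (CliffordAlgebra Q3) := .of_isTorsionFree ℝ _
  rw [star_add, star_ι, CliffordAlgebra.star_smul, star_pseudoscalar, neg_add,
    add_right_inj, self_eq_neg] at h
  exact ⟨w, by rw [h, add_zero]⟩

/-- Under the Spin-type action `x ↦ g * x * star g` by an even element `g`,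
1-vectors are mapped to 1-vectors. -/
theorem stmt8 (g : CliffordAlgebra Q3) (hg : g ∈ CliffordAlgebra.even Q3)
    (v : Fin 3 → ℝ) :
    g * ι Q3 v * cstar g ∈ LinearMap.range (ι Q3) := by
  change g * ι Q3 v * star g ∈ _
  have hg₀ : g ∈ evenOdd Q3 0 := by rwa [← even_toSubmodule]
  have hs : star g ∈ evenOdd Q3 0 := by
    rwa [star_def, reverse_mem_evenOdd_iff, involute_mem_evenOdd_iff]
  refine mem_range_ι_of_odd_of_star_eq_neg ?_ ?_
  · exact SetLike.mul_mem_graded (i := (1 : ZMod 2)) (j := 0)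
      (SetLike.mul_mem_graded (i := (0 : ZMod 2)) (j := 1) hg₀ (ι_mem_evenOdd_one Q3 v)) hs
  · rw [star_mul, star_mul, star_star, star_ι, neg_mul, mul_neg, mul_assoc]

end
end

section
/- Let a ∈ ℝ and v ∈ ℝ³, and set g := a·1 + ι(v) ∈ Cl₀,₃. Then g satisfies both defining conditions of Pin(3) — namely g·star(g) = 1 and involute(g)·ι(x)·star(g) lies in the image of ι for every x ∈ ℝ³ — if and only if either (v = 0 and a = 1 or a = −1) or (a = 0 and v₁² + v₂² + v₃² = 1). That is, the Pin(3) elements of the form scalar-plus-vector are exactly ±1 and the unit vectors. -/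
noncomputable section

open CliffordAlgebra

section ScalarPlusVector

variable {K M : Type*} [Field K] [AddCommGroup M] [Module K M]
  {Q : QuadraticForm K M}

theorem algebraMap_mem_range_ι_iff [Invertible (2 : K)] {r : K} :
    algebraMap K (CliffordAlgebra Q) r ∈ LinearMap.range (ι Q) ↔ r = 0 := by
  refine ⟨?_, fun h => by simp [h]⟩
  rintro ⟨w, hw⟩
  have hneg : algebraMap K (CliffordAlgebra Q) r = -algebraMap K (CliffordAlgebra Q) r := by
    nth_rewrite 1 [← AlgHom.commutes involute r]
    rw [← hw, involute_ι]
  have hr : r = -r := (algebraMap K (CliffordAlgebra Q)).injective (by simpa using hneg)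
  have h2 : (2 : K) * r = 0 := by linear_combination hr
  exact (mul_eq_zero.mp h2).resolve_left (Invertible.ne_zero 2)

theorem algebraMap_add_ι_mul_algebraMap_sub_ι (a : K) (v : M) :
    (algebraMap K (CliffordAlgebra Q) a + ι Q v) * (algebraMap K (CliffordAlgebra Q) a - ι Q v) =
      algebraMap K (CliffordAlgebra Q) (a ^ 2 - Q v) := by
  rw [map_sub, map_pow, ← ι_sq_scalar, add_mul, mul_sub, mul_sub, Algebra.commutes a (ι Q v), sq]
  abel

theorem algebraMap_sub_ι_mul_ι_mul_algebraMap_sub_ι (a : K) (v x : M) :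
    (algebraMap K (CliffordAlgebra Q) a - ι Q v) * ι Q x *
        (algebraMap K (CliffordAlgebra Q) a - ι Q v) =
      ι Q (a ^ 2 • x + (QuadraticMap.polar Q v x • v - Q v • x)) -
        algebraMap K (CliffordAlgebra Q) (a * QuadraticMap.polar Q v x) := by
  rw [map_add, ← ι_mul_ι_mul_ι, map_mul, ← ι_mul_ι_add_swap, map_smul]
  simp only [Algebra.algebraMap_eq_smul_one, sub_mul, mul_sub, mul_add, smul_mul_assoc,
    mul_smul_comm, one_mul, mul_one, sq, mul_smul, smul_sub]
  abel

theorem algebraMap_sub_ι_mul_ι_mul_mem_range_ι_iff [Invertible (2 : K)] (a : K) (v x : M) :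
    (algebraMap K (CliffordAlgebra Q) a - ι Q v) * ι Q x *
        (algebraMap K (CliffordAlgebra Q) a - ι Q v) ∈ LinearMap.range (ι Q) ↔
      a * QuadraticMap.polar Q v x = 0 := by
  rw [algebraMap_sub_ι_mul_ι_mul_algebraMap_sub_ι,
    Submodule.sub_mem_iff_right _ (LinearMap.mem_range_self _ _), algebraMap_mem_range_ι_iff]

end ScalarPlusVector

theorem Q3_apply (v : Fin 3 → ℝ) : Q3 v = -(v 0 ^ 2 + v 1 ^ 2 + v 2 ^ 2) := by
  simp only [Q3, QuadraticMap.weightedSumSquares_apply, Fin.sum_univ_three, smul_eq_mul]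
  ring

theorem Q3_eq_zero_iff {v : Fin 3 → ℝ} : Q3 v = 0 ↔ v = 0 := by
  refine ⟨fun h => ?_, fun h => by simp [h]⟩
  rw [Q3_apply] at h
  ext i
  fin_cases i <;> simp only [Fin.reduceFinMk, Fin.zero_eta, Fin.mk_one, Pi.zero_apply] <;>
    nlinarith [sq_nonneg (v 0), sq_nonneg (v 1), sq_nonneg (v 2)]

theorem cstar_algebraMap_add_ι (a : ℝ) (v : Fin 3 → ℝ) :
    cstar (algebraMap ℝ (CliffordAlgebra Q3) a + ι Q3 v) =
      algebraMap ℝ (CliffordAlgebra Q3) a - ι Q3 v := by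
  simp [cstar, sub_eq_add_neg]

theorem involute_algebraMap_add_ι (a : ℝ) (v : Fin 3 → ℝ) :
    involute (algebraMap ℝ (CliffordAlgebra Q3) a + ι Q3 v) =
      algebraMap ℝ (CliffordAlgebra Q3) a - ι Q3 v := by
  simp [sub_eq_add_neg]

/-- An element `g = a·1 + ι(v)` of `Cl₀,₃` satisfies the defining conditions of
`Pin(3)` (`g·star g = 1` and the twisted action maps 1-vectors to 1-vectors) iff
either `v = 0` and `a = ±1`, or `a = 0` and `v` is a unit vector. -/
theorem stmt15 (a : ℝ) (v : Fin 3 → ℝ) :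
    ((algebraMap ℝ (CliffordAlgebra Q3) a + ι Q3 v) *
        cstar (algebraMap ℝ (CliffordAlgebra Q3) a + ι Q3 v) = 1 ∧
      ∀ x : Fin 3 → ℝ,
        involute (algebraMap ℝ (CliffordAlgebra Q3) a + ι Q3 v) * ι Q3 x *
            cstar (algebraMap ℝ (CliffordAlgebra Q3) a + ι Q3 v)
          ∈ LinearMap.range (ι Q3)) ↔
    ((v = 0 ∧ (a = 1 ∨ a = -1)) ∨ (a = 0 ∧ v 0 ^ 2 + v 1 ^ 2 + v 2 ^ 2 = 1)) := by
  have hnorm : algebraMap ℝ (CliffordAlgebra Q3) (a ^ 2 - Q3 v) = 1 ↔ a ^ 2 - Q3 v = 1 := by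
    rw [← map_one (algebraMap ℝ (CliffordAlgebra Q3)),
      (algebraMap ℝ (CliffordAlgebra Q3)).injective.eq_iff]
  simp only [cstar_algebraMap_add_ι, involute_algebraMap_add_ι,
    algebraMap_add_ι_mul_algebraMap_sub_ι, algebraMap_sub_ι_mul_ι_mul_mem_range_ι_iff, hnorm]
  constructor
  · rintro ⟨h1, h2⟩
    have hv := h2 v
    rw [QuadraticMap.polar_self, mul_eq_zero, smul_eq_zero_iff_right two_ne_zero,
      Q3_eq_zero_iff] at hv
    rcases hv with rfl | rfl
    · right
      rw [Q3_apply] at h1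
      exact ⟨rfl, by linarith⟩
    · left
      exact ⟨rfl, by simpa using h1⟩
  · rintro (⟨rfl, ha⟩ | ⟨rfl, hv⟩)
    · exact ⟨by simpa using ha, fun x => by simp⟩
    · exact ⟨by rw [Q3_apply]; linarith, fun x => zero_mul _⟩

end
end
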